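/- Let (R,m) be a Cohen-Macaulay Noetherian local ring of dimension d > 0 with infinite residue field and let I be an m-primary ideal. Then e_0(I) − e_1(I) ≤ λ(R/I). -/

import Mathlib

open Finset IsLocalRing

/-- The length of an `R`-module `M`: the Krull dimension of its lattice of submodules,
i.e. the supremum of the lengths of chains of submodules of `M`. -/
noncomputable def moduleLength (R M : Type*) [CommRing R] [AddCommGroup M] [Module R M] :
    WithBot ℕ∞ :=
  Order.krullDim (Submodule R M)

/-- A local Noetherian ring is Cohen-Macaulay if its depth equals its Krull dimension,
equivalently, if it admits a regular sequence in the maximal ideal whose length is the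
Krull dimension. -/
def IsCohenMacaulayLocalRing (R : Type*) [CommRing R] [IsLocalRing R] : Prop :=
  ∃ rs : List R, (∀ x ∈ rs, x ∈ maximalIdeal R) ∧
    RingTheory.Sequence.IsRegular R rs ∧ (rs.length : WithBot ℕ∞) = ringKrullDim R

/-- `e 0, …, e d` are the Hilbert coefficients of an ideal `I` in a ring of dimension `d`:
for all large `n`, `λ(R ⧸ I^(n+1)) = ∑_{i=0}^{d} (-1)^i (e i) C(n+d-i, d-i)`. -/
def HasHilbertCoeffs {R : Type*} [CommRing R] (I : Ideal R) (d : ℕ) (e : ℕ → ℤ) : Prop :=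
  ∃ N : ℕ, ∀ n ≥ N, ∃ l : ℕ,
    moduleLength R (R ⧸ I ^ (n + 1)) = (l : WithBot ℕ∞) ∧
    (l : ℤ) = ∑ i ∈ Finset.range (d + 1), (-1 : ℤ) ^ i * e i * ((n + d - i).choose (d - i))

section Avoidance

/-- Over a local ring with infinite residue field, a finite module is not a union of finitely many
proper submodules. -/
lemma exists_forall_notMem_of_infinite_residueField {R M : Type*} [CommRing R] [IsLocalRing R]
    [Infinite (ResidueField R)] [AddCommGroup M] [Module R M] [Module.Finite R M]
    (s : Set (Submodule R M)) (hs : s.Finite) (h : ∀ W ∈ s, W ≠ ⊤) :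
    ∃ x : M, ∀ W ∈ s, x ∉ W := by
  classical
  let V := M ⧸ (maximalIdeal R • ⊤ : Submodule R M)
  let : Field (R ⧸ maximalIdeal R) := Ideal.Quotient.field _
  have : Infinite (R ⧸ maximalIdeal R) := ‹Infinite (ResidueField R)›
  let π : M →ₗ[R] V := Submodule.mkQ _
  let f : Submodule R M → Submodule (R ⧸ maximalIdeal R) V := fun W =>
    Submodule.span _ (W.map π : Set V)
  have hf (W : Submodule R M) : (f W : Set V) = W.map π := by
    rw [Submodule.coe_span_eq_span_of_surjective R _ Ideal.Quotient.mk_surjective,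
      Submodule.span_eq]
  have htop : (⊤ : Submodule (R ⧸ maximalIdeal R) V) ∉ hs.toFinset.image f := by
    intro hmem
    obtain ⟨W, hW, hWt⟩ := Finset.mem_image.mp hmem
    rw [Set.Finite.mem_toFinset] at hW
    refine h W hW ?_
    have hmap : W.map π = ⊤ := by
      apply SetLike.coe_injective
      rw [← hf, hWt]; rfl
    exact IsLocalRing.map_mkQ_eq_top.mp hmap
  obtain ⟨v, hv⟩ := (Set.ne_univ_iff_exists_notMem _).mp
    (Subspace.biUnion_ne_univ_of_top_notMem htop)
  obtain ⟨x, rfl⟩ := Submodule.mkQ_surjective _ v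
  refine ⟨x, fun W hW hx => hv ?_⟩
  refine Set.mem_biUnion (Finset.mem_coe.mpr (Finset.mem_image_of_mem f (hs.mem_toFinset.mpr hW))) ?_
  rw [hf]
  exact ⟨x, hx, rfl⟩

end Avoidance

section Length

variable {R : Type*} [CommRing R]

lemma length_quotient_eq_add_of_mul_mem_iff (x : R) (Q Q' : Ideal R)
    (h : ∀ a, x * a ∈ Q ↔ a ∈ Q') :
    Module.length R (R ⧸ Q) =
      Module.length R (R ⧸ Q') + Module.length R (R ⧸ (Q ⊔ Ideal.span {x})) := by
  have hle : Q' ≤ Submodule.comap (LinearMap.mulLeft R x) Q := fun a ha => (h a).mpr ha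
  refine Module.length_eq_add_of_exact (Submodule.mapQ Q' Q (LinearMap.mulLeft R x) hle)
    (Submodule.factor (le_sup_left : Q ≤ Q ⊔ Ideal.span {x})) ?_
    (Submodule.factor_surjective _) ?_
  · rw [← LinearMap.ker_eq_bot, LinearMap.ker_eq_bot']
    intro a ha
    obtain ⟨a, rfl⟩ := Submodule.mkQ_surjective _ a
    rw [Submodule.mkQ_apply, Submodule.mapQ_apply, Submodule.Quotient.mk_eq_zero] at ha
    rw [Submodule.mkQ_apply, Submodule.Quotient.mk_eq_zero]
    exact (h a).mp ha
  · intro b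
    obtain ⟨b, rfl⟩ := Submodule.mkQ_surjective _ b
    change (Submodule.Quotient.mk b : R ⧸ (Q ⊔ Ideal.span {x})) = 0 ↔ _
    rw [Submodule.mkQ_apply, Submodule.Quotient.mk_eq_zero, Submodule.mem_sup]
    constructor
    · rintro ⟨q, hq, y, hy, rfl⟩
      obtain ⟨a, rfl⟩ := Ideal.mem_span_singleton'.mp hy
      refine ⟨Submodule.Quotient.mk a, ?_⟩
      rw [Submodule.mapQ_apply, Submodule.Quotient.eq]
      simpa [mul_comm] using hq
    · rintro ⟨a, ha⟩
      obtain ⟨a, rfl⟩ := Submodule.mkQ_surjective _ a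
      rw [Submodule.mkQ_apply, Submodule.mapQ_apply, Submodule.Quotient.eq] at ha
      refine ⟨_, Q.neg_mem ha, x * a, Ideal.mem_span_singleton'.mpr ⟨a, mul_comm _ _⟩, ?_⟩
      simp

lemma length_quotient_map_mk_span_singleton (x : R) (Q : Ideal R) :
    Module.length (R ⧸ Ideal.span {x})
        ((R ⧸ Ideal.span {x}) ⧸ Q.map (Ideal.Quotient.mk (Ideal.span {x}))) =
      Module.length R (R ⧸ (Q ⊔ Ideal.span {x})) := by
  rw [← Module.length_eq_of_surjective (S := R) (R := R ⧸ Ideal.span {x})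
    Ideal.Quotient.mk_surjective, sup_comm]
  exact (DoubleQuot.quotQuotEquivQuotSupₐ R (Ideal.span {x}) Q).toLinearEquiv.length_eq

/-- If `x` is regular, then `λ(R/xQ) = λ(R/Q) + λ(R/x)`, hence `λ(R/xⁿQ) = λ(R/Q) + n λ(R/x)`. -/
lemma length_quotient_span_pow_mul {x : R} (hx : IsSMulRegular R x) (Q : Ideal R) (n : ℕ) :
    Module.length R (R ⧸ (Ideal.span {x ^ n} * Q)) =
      Module.length R (R ⧸ Q) + n * Module.length R (R ⧸ Ideal.span {x}) := by
  induction n with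
  | zero => rw [pow_zero, Ideal.span_singleton_one, ← Ideal.one_eq_top, one_mul]; simp
  | succ n ih =>
    have hmem (a : R) :
        x * a ∈ Ideal.span {x ^ (n + 1)} * Q ↔ a ∈ Ideal.span {x ^ n} * Q := by
      simp only [Ideal.mem_span_singleton_mul, pow_succ', mul_assoc]
      exact exists_congr fun z => and_congr_right fun _ => hx.eq_iff
    have hsup : Ideal.span {x ^ (n + 1)} * Q ⊔ Ideal.span {x} = Ideal.span {x} :=
      sup_eq_right.mpr (Ideal.mul_le_left.trans
        (Ideal.span_singleton_le_span_singleton.mpr (dvd_pow_self x n.succ_ne_zero)))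
    rw [length_quotient_eq_add_of_mul_mem_iff x _ _ hmem, hsup, ih, Nat.cast_succ, add_mul,
      one_mul, add_assoc]

end Length

section Superficial

/-- If every associated prime of `M` containing `y` contains `J`, then the kernel of multiplication
by `y` on `M` is killed by a power of `J`. -/
lemma exists_pow_le_annihilator_torsionBy {A M : Type*} [CommRing A] [IsNoetherianRing A]
    [AddCommGroup M] [Module A M] [Module.Finite A M] (J : Ideal A) (y : A)
    (h : ∀ P ∈ associatedPrimes A M, y ∈ P → J ≤ P) :
    ∃ c : ℕ, J ^ c ≤ Module.annihilator A (Submodule.torsionBy A M y) := by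
  refine Ideal.exists_pow_le_of_le_radical_of_fg ?_ (IsNoetherian.noetherian J)
  rw [← Ideal.sInf_minimalPrimes]
  refine le_sInf fun P hP => h P ?_ ?_
  · exact associatedPrimes.subset_of_injective (Submodule.subtype_injective _)
      (Module.associatedPrimes.minimalPrimes_annihilator_subset_associatedPrimes A _ hP)
  · refine hP.1.2 (Module.mem_annihilator.mpr fun m => ?_)
    exact Submodule.smul_torsionBy y m

lemma exists_finite_forall_pow_mul_mem {A : Type*} [CommRing A] [IsNoetherianRing A]
    (B J : Ideal A) : ∃ S : Set (Ideal A), S.Finite ∧ ∀ y : A, (∀ P ∈ S, y ∈ P → J ≤ P) →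
      ∃ c : ℕ, ∀ f, y * f ∈ B → ∀ g ∈ J ^ c, g * f ∈ B := by
  refine ⟨associatedPrimes A (A ⧸ B), associatedPrimes.finite _ _, fun y hy => ?_⟩
  obtain ⟨c, hc⟩ := exists_pow_le_annihilator_torsionBy J y hy
  refine ⟨c, fun f hf g hg => ?_⟩
  have hmem : Submodule.Quotient.mk f ∈ Submodule.torsionBy A (A ⧸ B) y := by
    rwa [Submodule.mem_torsionBy_iff, ← Submodule.Quotient.mk_smul, Submodule.Quotient.mk_eq_zero]
  have hann := congrArg Subtype.val (Module.mem_annihilator.mp (hc hg) ⟨_, hmem⟩)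
  rwa [Submodule.coe_smul, ← Submodule.Quotient.mk_smul, Submodule.coe_zero,
    Submodule.Quotient.mk_eq_zero] at hann

variable {R : Type*} [CommRing R] (I : Ideal R)

/-- The ideal `⨁ I ^ (n + 1)` of the Rees algebra `⨁ I ^ n`. -/
def reesShiftIdeal : Ideal (reesAlgebra I) where
  carrier := {f | ∀ n, (f : Polynomial R).coeff n ∈ I ^ (n + 1)}
  zero_mem' n := by simp
  add_mem' hf hg n := by simpa using add_mem (hf n) (hg n)
  smul_mem' g f hf n := by
    simp only [smul_eq_mul, Subalgebra.coe_mul, Polynomial.coeff_mul]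
    refine sum_mem fun p hp => ?_
    rw [← (Finset.HasAntidiagonal.mem_antidiagonal.mp hp), add_assoc, pow_add]
    exact Ideal.mul_mem_mul (g.2 p.1) (hf p.2)

variable {I}

lemma mem_reesShiftIdeal_iff {f : reesAlgebra I} :
    f ∈ reesShiftIdeal I ↔ ∀ n, (f : Polynomial R).coeff n ∈ I ^ (n + 1) := Iff.rfl

/-- The element `a tⁿ` of the Rees algebra. -/
noncomputable def reesMonomial (n : ℕ) : ↥(I ^ n) →ₗ[R] reesAlgebra I where
  toFun a := ⟨Polynomial.monomial n (a : R), reesAlgebra.monomial_mem.mpr a.2⟩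
  map_add' a b := by ext1; simp
  map_smul' r a := by ext1; simp [Polynomial.smul_monomial]

lemma reesMonomial_mul {m n : ℕ} (a : ↥(I ^ m)) (b : ↥(I ^ n)) :
    reesMonomial m a * reesMonomial n b =
      reesMonomial (m + n) ⟨(a : R) * b, by rw [pow_add]; exact Ideal.mul_mem_mul a.2 b.2⟩ := by
  ext1
  simp [reesMonomial, Polynomial.monomial_mul_monomial]

lemma reesMonomial_mem_reesShiftIdeal_iff {n : ℕ} {a : ↥(I ^ n)} :
    reesMonomial n a ∈ reesShiftIdeal I ↔ (a : R) ∈ I ^ (n + 1) := by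
  rw [mem_reesShiftIdeal_iff]
  refine ⟨fun h => by simpa [reesMonomial] using h n, fun h m => ?_⟩
  simp only [reesMonomial, LinearMap.coe_mk, AddHom.coe_mk, Polynomial.coeff_monomial]
  split_ifs with hm
  · exact hm ▸ h
  · exact zero_mem _

variable (I) in
/-- The ideal of the Rees algebra generated by the elements of degree one. -/
noncomputable def reesPlus : Ideal (reesAlgebra I) :=
  Ideal.span (Set.range (reesMonomial (I := I) 1))

lemma reesMonomial_mem_reesPlus_pow {n : ℕ} (b : ↥(I ^ n)) :
    reesMonomial n b ∈ reesPlus I ^ n := by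
  induction n with
  | zero => simp
  | succ n ih =>
    obtain ⟨b, hb⟩ := b
    have hb' := hb
    rw [pow_succ] at hb'
    induction hb' using Submodule.mul_induction_on' with
    | mem_mul_mem u hu v hv =>
      have := reesMonomial_mul (I := I) ⟨u, hu⟩ (⟨v, by rwa [pow_one]⟩ : ↥(I ^ 1))
      rw [← this, pow_succ]
      exact Ideal.mul_mem_mul (ih _) (Ideal.subset_span ⟨_, rfl⟩)
    | add u hu v hv h₁ h₂ =>
      rw [← pow_succ] at hu hv
      have := (reesMonomial (I := I) (n + 1)).map_add ⟨u, hu⟩ ⟨v, hv⟩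
      exact this ▸ add_mem (h₁ hu) (h₂ hv)

/-- In a Noetherian local ring with infinite residue field, any ideal `I` contains an element which
is superficial of degree one, up to multiplication by a power of `I`, and avoids finitely many given
prime ideals not containing `I`. -/
lemma exists_mem_forall_notMem_and_pow_mul_mem [IsNoetherianRing R] [IsLocalRing R]
    [Infinite (ResidueField R)] (I : Ideal R) (T : Set (Ideal R)) (hT : T.Finite)
    (hIT : ∀ p ∈ T, ¬ I ≤ p) :
    ∃ x ∈ I, (∀ p ∈ T, x ∉ p) ∧ ∃ c : ℕ, ∀ n, ∀ a ∈ I ^ n, x * a ∈ I ^ (n + 2) →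
      ∀ b ∈ I ^ c, b * a ∈ I ^ (n + c + 1) := by
  obtain ⟨S, hS, hSc⟩ := exists_finite_forall_pow_mul_mem (reesShiftIdeal I) (reesPlus I)
  let τ : I →ₗ[R] reesAlgebra I :=
    reesMonomial 1 ∘ₗ Submodule.inclusion (pow_one I).ge
  let W₁ : Ideal R → Submodule R I := fun p => Submodule.comap (Submodule.subtype I) p
  let W₂ : Ideal (reesAlgebra I) → Submodule R I := fun P => (P.restrictScalars R).comap τ
  obtain ⟨⟨x, hxI⟩, hx⟩ := exists_forall_notMem_of_infinite_residueField
    (W₁ '' T ∪ (W₂ '' S \ {⊤})) ((hT.image _).union (hS.image _).sdiff) (by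
      rintro W (⟨p, hp, rfl⟩ | ⟨-, hW⟩)
      · intro h
        refine hIT p hp fun a ha => ?_
        have : (⟨a, ha⟩ : I) ∈ W₁ p := h ▸ Submodule.mem_top
        exact this
      · exact hW)
  refine ⟨x, hxI, fun p hp hxp => hx _ (Or.inl ⟨p, hp, rfl⟩) hxp, ?_⟩
  obtain ⟨c, hc⟩ := hSc (τ ⟨x, hxI⟩) (by
      intro P hP hxP
      have htop : W₂ P = ⊤ := by
        by_contra h
        exact hx _ (Or.inr ⟨⟨P, hP, rfl⟩, h⟩) hxP
      rw [reesPlus, Ideal.span_le]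
      rintro _ ⟨⟨a, ha⟩, rfl⟩
      have : (⟨a, by rwa [pow_one] at ha⟩ : I) ∈ W₂ P := htop ▸ Submodule.mem_top
      exact this)
  refine ⟨c, fun n a ha hxa b hb => ?_⟩
  have hmem : τ ⟨x, hxI⟩ * reesMonomial n ⟨a, ha⟩ ∈ reesShiftIdeal I := by
    rw [LinearMap.comp_apply, reesMonomial_mul, reesMonomial_mem_reesShiftIdeal_iff]
    have : 1 + n + 1 = n + 2 := by ring
    rwa [this]
  have hann := hc _ hmem _ (reesMonomial_mem_reesPlus_pow ⟨b, hb⟩)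
  rw [reesMonomial_mul, reesMonomial_mem_reesShiftIdeal_iff] at hann
  rw [add_comm n c]
  exact hann

/-- The filtration `I ^ n ⊓ (I ^ (n + 2) : x)`. -/
def colonFiltration (I : Ideal R) (x : R) : I.Filtration R where
  N n := I ^ n ⊓ Submodule.comap (LinearMap.mulLeft R x) (I ^ (n + 2))
  mono n := inf_le_inf (Ideal.pow_le_pow_right n.le_succ)
    (Submodule.comap_mono (Ideal.pow_le_pow_right (Nat.succ_le_succ (Nat.le_succ _))))
  smul_le n := by
    refine Submodule.smul_le.mpr fun r hr a ha => ⟨?_, ?_⟩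
    · rw [pow_succ']
      exact Ideal.mul_mem_mul hr ha.1
    · change x * (r * a) ∈ I ^ (n + 1 + 2)
      rw [mul_left_comm, add_right_comm, pow_succ']
      exact Ideal.mul_mem_mul hr ha.2

lemma exists_forall_ge_mul_mem_iff [IsNoetherianRing R] {x : R} (hx : IsSMulRegular R x)
    (hxI : x ∈ I) {c : ℕ} (hc : ∀ n, ∀ a ∈ I ^ n, x * a ∈ I ^ (n + 2) →
      ∀ b ∈ I ^ c, b * a ∈ I ^ (n + c + 1)) :
    ∃ N, ∀ n ≥ N, ∀ a, x * a ∈ I ^ (n + 1) ↔ a ∈ I ^ n := by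
  have hstable : (colonFiltration I x).Stable := by
    refine (I.stableFiltration_stable (⊤ : Submodule R R)).of_le fun n => ?_
    change _ ≤ I ^ n • (⊤ : Submodule R R)
    rw [smul_eq_mul, Ideal.mul_top]
    exact inf_le_left
  obtain ⟨n₀, hn₀⟩ := hstable.exists_pow_smul_eq
  have hstep (n : ℕ) (hn : n₀ + c ≤ n) (a : R) (ha : a ∈ I ^ n) (hxa : x * a ∈ I ^ (n + 2)) :
      a ∈ I ^ (n + 1) := by
    obtain ⟨k, rfl⟩ := Nat.exists_eq_add_of_le hn
    have hle : I ^ c • (colonFiltration I x).N n₀ ≤ I ^ (n₀ + c + 1) :=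
      Submodule.smul_le.mpr fun b hb a ha => hc n₀ a ha.1 ha.2 b hb
    have hmem : a ∈ (colonFiltration I x).N (n₀ + (k + c)) := by
      rw [add_comm k c, ← add_assoc]
      exact ⟨ha, hxa⟩
    rw [hn₀, pow_add, mul_smul] at hmem
    have := (smul_mono_right (I ^ k) hle) hmem
    rw [smul_eq_mul, ← pow_add] at this
    convert this using 2
    ring
  obtain ⟨k, hk⟩ := I.exists_pow_inf_eq_pow_smul (Ideal.span {x})
  refine ⟨n₀ + c + k, fun n hn a => ⟨fun h => ?_, fun h => ?_⟩⟩
  · have hbase : a ∈ I ^ (n₀ + c) := by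
      have hmem : x * a ∈ I ^ (n + 1) • (⊤ : Submodule R R) ⊓ Ideal.span {x} :=
        ⟨by rwa [smul_eq_mul, Ideal.mul_top], Ideal.mul_mem_right _ _ (Ideal.mem_span_singleton_self x)⟩
      rw [hk _ (by omega)] at hmem
      have hmem' : x * a ∈ I ^ (n + 1 - k) • Ideal.span {x} :=
        Submodule.smul_mono le_rfl inf_le_right hmem
      rw [smul_eq_mul, mul_comm, Ideal.mem_span_singleton_mul] at hmem'
      obtain ⟨b, hb, hba⟩ := hmem'
      rw [← hx hba]
      exact Ideal.pow_le_pow_right (by omega) hb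
    have hind (j : ℕ) (hj : n₀ + c ≤ j) : j ≤ n → a ∈ I ^ j := by
      induction j, hj using Nat.le_induction with
      | base => exact fun _ => hbase
      | succ j hj ih =>
        exact fun hjn => hstep j hj a (ih (by omega)) (Ideal.pow_le_pow_right (by omega) h)
    exact hind n (by omega) le_rfl
  · rw [pow_succ']
    exact Ideal.mul_mem_mul hxI h

end Superficial

section HilbertCoeffs

variable {R : Type*} [CommRing R]

lemma moduleLength_eq_length (M : Type*) [AddCommGroup M] [Module R M] :
    moduleLength R M = (Module.length R M : WithBot ℕ∞) :=
  (Module.coe_length R M).symm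

lemma moduleLength_eq_natCast_iff {M : Type*} [AddCommGroup M] [Module R M] {l : ℕ} :
    moduleLength R M = (l : WithBot ℕ∞) ↔ Module.length R M = l := by
  rw [moduleLength_eq_length]
  exact WithBot.coe_inj

/-- If multiplication by `x` shifts the powers of `I` in large degrees, then the Hilbert
coefficients of the image of `I` in `R/x` are those of `I`, except for the last one. -/
lemma HasHilbertCoeffs.map_quotient_span_singleton {I : Ideal R} {d : ℕ} {e : ℕ → ℤ}
    (he : HasHilbertCoeffs I (d + 1) e) {x : R}
    (hx : ∃ N, ∀ n ≥ N, ∀ a, x * a ∈ I ^ (n + 1) ↔ a ∈ I ^ n) :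
    HasHilbertCoeffs (I.map (Ideal.Quotient.mk (Ideal.span {x}))) d e := by
  obtain ⟨N, hN⟩ := he
  obtain ⟨N', hN'⟩ := hx
  refine ⟨N + N' + 1, fun n hn => ?_⟩
  obtain ⟨m, rfl⟩ : ∃ m, n = m + 1 := ⟨n - 1, by omega⟩
  obtain ⟨l₁, hl₁, hs₁⟩ := hN (m + 1) (by omega)
  obtain ⟨l₂, hl₂, hs₂⟩ := hN m (by omega)
  rw [moduleLength_eq_natCast_iff] at hl₁ hl₂
  have hlen := length_quotient_eq_add_of_mul_mem_iff x _ _ (hN' (m + 1) (by omega))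
  rw [hl₁, hl₂] at hlen
  have hfin : Module.length R (R ⧸ (I ^ (m + 1 + 1) ⊔ Ideal.span {x})) ≠ ⊤ := by
    rintro h
    rw [h, add_top] at hlen
    exact ENat.natCast_ne_top _ hlen
  obtain ⟨l, hl⟩ := ENat.ne_top_iff_exists.mp hfin
  refine ⟨l, ?_, ?_⟩
  · rw [moduleLength_eq_natCast_iff, ← Ideal.map_pow, length_quotient_map_mk_span_singleton, hl]
  · rw [← hl] at hlen
    have hlen' : l₁ = l₂ + l := by exact_mod_cast hlen
    have : (l : ℤ) = l₁ - l₂ := by rw [hlen']; push_cast; ring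
    rw [this, hs₁, hs₂, ← Finset.sum_sub_distrib, Finset.sum_range_succ]
    simp only [Nat.sub_self, Nat.choose_zero_right, sub_self, add_zero]
    refine Finset.sum_congr rfl fun i hi => ?_
    have hi' : i ≤ d := Nat.lt_succ_iff.mp (Finset.mem_range.mp hi)
    obtain ⟨j, rfl⟩ := Nat.exists_eq_add_of_le hi'
    have h₁ : m + 1 + (i + j + 1) - i = m + 1 + j + 1 := by omega
    have h₂ : m + (i + j + 1) - i = m + 1 + j := by omega
    have h₃ : m + 1 + (i + j) - i = m + 1 + j := by omega
    have h₄ : i + j + 1 - i = j + 1 := by omega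
    have h₅ : i + j - i = j := by omega
    rw [h₁, h₂, h₃, h₄, h₅, Nat.choose_succ_succ]
    push_cast
    ring

/-- The multiplicity in dimension zero is the length of the ring. -/
lemma HasHilbertCoeffs.length_eq_of_zero [IsNoetherianRing R] [IsLocalRing R] {I : Ideal R}
    (hI : I ≤ maximalIdeal R) {e : ℕ → ℤ} (he : HasHilbertCoeffs I 0 e) :
    ∃ l : ℕ, Module.length R R = l ∧ (l : ℤ) = e 0 := by
  obtain ⟨N, hN⟩ := he
  obtain ⟨l₁, hl₁, hs₁⟩ := hN N le_rfl
  obtain ⟨l₂, hl₂, hs₂⟩ := hN (N + 1) (by omega)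
  rw [moduleLength_eq_natCast_iff] at hl₁ hl₂
  simp only [zero_add, Finset.range_one, Finset.sum_singleton, pow_zero, one_mul, Nat.sub_zero,
    add_zero, Nat.choose_zero_right, Nat.cast_one, mul_one] at hs₁ hs₂
  have hl : l₁ = l₂ := by exact_mod_cast hs₁.trans hs₂.symm
  subst hl
  have hker : I ^ (N + 1) ≤ I ^ (N + 1 + 1) := by
    let f := Submodule.factor (Ideal.pow_le_pow_right (N + 1).le_succ : I ^ (N + 1 + 1) ≤ I ^ (N + 1))
    have hf := Module.length_eq_add_of_exact (LinearMap.ker f).subtype f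
      (Submodule.subtype_injective _) (Submodule.factor_surjective _) f.exact_subtype_ker_map
    rw [hl₁, hl₂] at hf
    have hz : Module.length R (LinearMap.ker f) = 0 := by
      have : (l₁ : ℕ∞) ≠ ⊤ := ENat.natCast_ne_top _
      exact ENat.add_left_injective_of_ne_top this (by simpa using hf.symm)
    rw [Module.length_eq_zero_iff, Submodule.subsingleton_iff_eq_bot] at hz
    intro a ha
    have hmem : (Submodule.Quotient.mk a : R ⧸ I ^ (N + 1 + 1)) ∈ LinearMap.ker f := by
      change (Submodule.Quotient.mk a : R ⧸ I ^ (N + 1)) = 0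
      rwa [Submodule.Quotient.mk_eq_zero]
    rw [hz, Submodule.mem_bot, Submodule.Quotient.mk_eq_zero] at hmem
    exact hmem
  have hbot : I ^ (N + 1) = ⊥ := by
    refine Submodule.eq_bot_of_le_smul_of_le_jacobson_bot I _ (IsNoetherian.noetherian _) ?_
      (hI.trans (maximalIdeal_le_jacobson _))
    rwa [smul_eq_mul, ← pow_succ']
  refine ⟨l₁, ?_, hs₁⟩
  rw [← hl₁, hbot]
  exact (Submodule.quotEquivOfEqBot ⊥ rfl).length_eq.symm

end HilbertCoeffs

section HyperplaneSection

variable {R : Type*} [CommRing R] [IsNoetherianRing R] [IsLocalRing R]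

/-- A hyperplane section: there is a regular `x ∈ I` such that `R/x` has a weakly regular sequence
of length one less and `I(R/x)` has the same Hilbert coefficients, except for the last one. -/
lemma exists_regular_hasHilbertCoeffs_quotient [Infinite (ResidueField R)] {rs : List R} {r : R}
    (hmem : ∀ y ∈ rs ++ [r], y ∈ maximalIdeal R)
    (hreg : RingTheory.Sequence.IsWeaklyRegular R (rs ++ [r])) {I : Ideal R}
    (hI : I ≤ maximalIdeal R) (hrad : maximalIdeal R ≤ I.radical) {d : ℕ} {e : ℕ → ℤ}
    (he : HasHilbertCoeffs I (d + 1) e) :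
    ∃ x ∈ I, IsSMulRegular R x ∧
      RingTheory.Sequence.IsWeaklyRegular (R ⧸ Ideal.span {x})
        (rs.map (Ideal.Quotient.mk (Ideal.span {x}))) ∧
      HasHilbertCoeffs (I.map (Ideal.Quotient.mk (Ideal.span {x}))) d e := by
  let M := R ⧸ (Ideal.ofList rs • ⊤ : Submodule R R)
  rw [RingTheory.Sequence.isWeaklyRegular_append_iff,
    RingTheory.Sequence.isWeaklyRegular_singleton_iff] at hreg
  obtain ⟨hrs, hr⟩ := hreg
  have hcompl := biUnion_associatedPrimes_eq_compl_regular R M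
  obtain ⟨x, hxI, hxT, c, hc⟩ := exists_mem_forall_notMem_and_pow_mul_mem I
    (associatedPrimes R M) (associatedPrimes.finite R M) (by
      intro p hp hIp
      have hrp : r ∈ p :=
        ((Ideal.radical_mono hIp).trans hp.isPrime.radical.le) (hrad (hmem r (by simp)))
      have : r ∈ {r : R | IsSMulRegular M r}ᶜ := hcompl ▸ Set.mem_biUnion hp hrp
      exact this hr)
  have hxM : IsSMulRegular M x := by
    by_contra h
    have : x ∈ ⋃ p ∈ associatedPrimes R M, (p : Set R) := hcompl ▸ h
    obtain ⟨p, hp, hxp⟩ := Set.mem_iUnion₂.mp this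
    exact hxT p hp hxp
  have hperm : RingTheory.Sequence.IsWeaklyRegular R (x :: rs) := by
    refine IsLocalRing.isWeaklyRegular_of_perm_of_subset_maximalIdeal
      ((RingTheory.Sequence.isWeaklyRegular_append_iff R rs [x]).mpr
        ⟨hrs, (RingTheory.Sequence.isWeaklyRegular_singleton_iff _ _).mpr hxM⟩)
      (List.perm_append_singleton x rs) ?_
    intro y hy
    rcases List.mem_append.mp hy with hy | hy
    · exact hmem y (List.mem_append_left _ hy)
    · rw [List.mem_singleton.mp hy]
      exact hI hxI
  rw [RingTheory.Sequence.isWeaklyRegular_cons_iff] at hperm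
  obtain ⟨hx, hrs'⟩ := hperm
  refine ⟨x, hxI, hx, ?_, he.map_quotient_span_singleton (exists_forall_ge_mul_mem_iff hx hxI hc)⟩
  refine (RingTheory.Sequence.isWeaklyRegular_map_algebraMap_iff (R ⧸ Ideal.span {x}) _ rs).mpr ?_
  refine (LinearEquiv.isWeaklyRegular_congr (Submodule.quotEquivOfEq _ _ ?_) rs).mp hrs'
  rw [← Submodule.ideal_span_singleton_smul, smul_eq_mul, Ideal.mul_top]

/-- The case of dimension one. -/
lemma e0_sub_e1_le_length_of_dim_one {I : Ideal R} (hI : I ≤ maximalIdeal R) {e : ℕ → ℤ}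
    (he : HasHilbertCoeffs I 1 e) {x : R} (hxI : x ∈ I) (hx : IsSMulRegular R x)
    (hex : HasHilbertCoeffs (I.map (Ideal.Quotient.mk (Ideal.span {x}))) 0 e)
    {l : ℕ} (hl : Module.length R (R ⧸ I) = l) : e 0 - e 1 ≤ l := by
  have hxm : Ideal.span {x} ≤ maximalIdeal R := by
    rw [Ideal.span_singleton_le_iff_mem]; exact hI hxI
  have : Nontrivial (R ⧸ Ideal.span {x}) :=
    Ideal.Quotient.nontrivial_iff.mpr (ne_top_of_le_ne_top (Ideal.IsPrime.ne_top inferInstance) hxm)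
  have : IsLocalRing (R ⧸ Ideal.span {x}) :=
    .of_surjective' (Ideal.Quotient.mk _) Ideal.Quotient.mk_surjective
  have : IsLocalHom (Ideal.Quotient.mk (Ideal.span {x})) :=
    Ideal.Quotient.mk_surjective.isLocalHom
  obtain ⟨q, hq, hqe⟩ := hex.length_eq_of_zero
    (Ideal.map_le_iff_le_comap.mpr (hI.trans (maximalIdeal_comap _).ge))
  rw [← Module.length_eq_of_surjective (S := R) Ideal.Quotient.mk_surjective] at hq
  obtain ⟨N, hN⟩ := he
  obtain ⟨k, hk, hks⟩ := hN N le_rfl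
  rw [moduleLength_eq_natCast_iff] at hk
  have hle : Ideal.span {x ^ N} * I ≤ I ^ (N + 1) := by
    rw [pow_succ]
    exact Ideal.mul_mono_left
      ((Ideal.span_singleton_le_iff_mem _).mpr (Ideal.pow_mem_pow hxI N))
  have hlen := Module.length_le_of_surjective (Submodule.factor hle) (Submodule.factor_surjective hle)
  rw [length_quotient_span_pow_mul hx, hk, hl, hq] at hlen
  have hlen' : (k : ℤ) ≤ l + N * q := by exact_mod_cast hlen
  rw [hks, hqe] at hlen'
  simp [Finset.sum_range_succ] at hlen'
  linarith

end HyperplaneSection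

lemma e0_sub_e1_le_length_of_isWeaklyRegular (d : ℕ) :
    ∀ {R : Type*} [CommRing R] [IsNoetherianRing R] [IsLocalRing R] [Infinite (ResidueField R)]
      (rs : List R), rs.length = d + 1 → (∀ y ∈ rs, y ∈ maximalIdeal R) →
      RingTheory.Sequence.IsWeaklyRegular R rs →
      ∀ (I : Ideal R), I ≤ maximalIdeal R → maximalIdeal R ≤ I.radical →
      ∀ e : ℕ → ℤ, HasHilbertCoeffs I (d + 1) e →
      ∀ l : ℕ, Module.length R (R ⧸ I) = l → e 0 - e 1 ≤ l := by
  induction d with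
  | zero =>
    intro R _ _ _ _ rs hlen hmem hreg I hI hrad e he l hl
    obtain ⟨rs, r, rfl⟩ := rs.eq_nil_or_concat'.resolve_left (by rintro rfl; simp at hlen)
    obtain ⟨x, hxI, hx, -, hex⟩ := exists_regular_hasHilbertCoeffs_quotient hmem hreg hI hrad he
    exact e0_sub_e1_le_length_of_dim_one hI he hxI hx hex hl
  | succ d ih =>
    intro R _ _ _ _ rs hlen hmem hreg I hI hrad e he l hl
    obtain ⟨rs, r, rfl⟩ := rs.eq_nil_or_concat'.resolve_left (by rintro rfl; simp at hlen)
    obtain ⟨x, hxI, hx, hreg', hex⟩ := exists_regular_hasHilbertCoeffs_quotient hmem hreg hI hrad he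
    have hxm : Ideal.span {x} ≤ maximalIdeal R := by
      rw [Ideal.span_singleton_le_iff_mem]; exact hI hxI
    have : Nontrivial (R ⧸ Ideal.span {x}) := Ideal.Quotient.nontrivial_iff.mpr
      (ne_top_of_le_ne_top (Ideal.IsPrime.ne_top inferInstance) hxm)
    let φ := Ideal.Quotient.mk (Ideal.span {x})
    have hφ : Function.Surjective φ := Ideal.Quotient.mk_surjective
    have : IsLocalRing (R ⧸ Ideal.span {x}) := .of_surjective' φ hφ
    have : IsLocalHom φ := hφ.isLocalHom
    have : Infinite (ResidueField (R ⧸ Ideal.span {x})) :=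
      .of_injective _ (ResidueField.map φ).injective
    have hcomap : (maximalIdeal (R ⧸ Ideal.span {x})).comap φ = maximalIdeal R :=
      maximalIdeal_comap φ
    refine ih (rs.map φ) (by simpa using hlen) ?_ hreg' (I.map φ) ?_ ?_ e hex l ?_
    · intro y hy
      obtain ⟨z, hz, rfl⟩ := List.mem_map.mp hy
      exact hcomap.ge (hmem z (List.mem_append_left _ hz))
    · exact Ideal.map_le_iff_le_comap.mpr (hI.trans hcomap.ge)
    · rw [← Ideal.map_comap_of_surjective φ hφ (maximalIdeal (R ⧸ Ideal.span {x})), hcomap]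
      exact (Ideal.map_mono hrad).trans (Ideal.map_radical_le φ)
    · rw [length_quotient_map_mk_span_singleton,
        sup_eq_left.mpr ((Ideal.span_singleton_le_iff_mem _).mpr hxI), hl]

/-- **Vasconcelos (1994), Corollary 3.3**.  If `(R,m)` is a Cohen-Macaulay Noetherian local
ring of dimension `d > 0` with infinite residue field and `I` is an `m`-primary ideal, then
`e₀(I) - e₁(I) ≤ λ(R/I)`. -/
theorem e0_sub_e1_le_length
    {R : Type*} [CommRing R] [IsNoetherianRing R] [IsLocalRing R]
    (d : ℕ) (hd : 0 < d) (hdim : ringKrullDim R = d)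
    (hCM : IsCohenMacaulayLocalRing R)
    (hres : Infinite (IsLocalRing.ResidueField R))
    (I : Ideal R) (hI : I.radical = maximalIdeal R)
    (e : ℕ → ℤ) (he : HasHilbertCoeffs I d e)
    (lI : ℕ) (hlI : moduleLength R (R ⧸ I) = (lI : WithBot ℕ∞)) :
    e 0 - e 1 ≤ (lI : ℤ) := by
  obtain ⟨rs, hmem, hreg, hlen⟩ := hCM
  obtain ⟨d, rfl⟩ := Nat.exists_eq_succ_of_ne_zero hd.ne'
  rw [hdim] at hlen
  exact e0_sub_e1_le_length_of_isWeaklyRegular d rs (by exact_mod_cast hlen) hmem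
    hreg.toIsWeaklyRegular I (hI ▸ Ideal.le_radical) hI.ge e he lI
    (moduleLength_eq_natCast_iff.mp hlI)
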